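/- arXiv:2209.01656 — 2 statements merged into one kernel-verified Lean document; each statement's English description precedes it below -/
import Mathlib

section
/- Let t and k be positive integers. There exists n0 = n0(t,k) such that for all n ≥ n0 with n+t even the following holds: let σ be a cyclic permutation of [n], let m be an integer with 0 ≤ m < k, and let G be a full consecutive σ-k-Sperner t-intersecting family of intervals of σ with min{|G| : G ∈ G} = (n+t)/2 − m and max{|G| : G ∈ G} ≤ (n+t)/2 + k − 1 + m; let g_i be the number of intervals of G of length (n+t)/2 + i. Then Σ_{i=−m}^{k+j−2} g_i ≤ k·n − Σ_{i=−m}^{−j} g_i for every integer j with 1 ≤ j ≤ m. -/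
open Finset

/-- `F` is `t`-intersecting: every two members intersect in at least `t` elements. -/
def TIntersecting {n : ℕ} (t : ℕ) (F : Finset (Finset (Fin n))) : Prop :=
  ∀ A ∈ F, ∀ B ∈ F, t ≤ (A ∩ B).card

/-- `σ` is a cyclic permutation of `[n]`: its cycle decomposition is a single `n`-cycle. -/
def IsCyclicPerm {n : ℕ} (σ : Equiv.Perm (Fin n)) : Prop :=
  σ.IsCycle ∧ σ.support = Finset.univ

/-- `F` is an interval of `σ`: `F = {x, σ x, …, σ^(ℓ-1) x}` for some `x`,
where `ℓ = |F|` satisfies `1 ≤ ℓ ≤ n - 1`. -/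
def IsIntervalOf {n : ℕ} (σ : Equiv.Perm (Fin n)) (F : Finset (Fin n)) : Prop :=
  1 ≤ F.card ∧ F.card ≤ n - 1 ∧
    ∃ x : Fin n, F = (Finset.range F.card).image (fun i => (σ ^ i) x)

/-- The chain `C_h`: the intervals of lengths `1, …, n-1` starting at `σ h`. -/
def chainAt {n : ℕ} (σ : Equiv.Perm (Fin n)) (h : Fin n) : Finset (Finset (Fin n)) :=
  (Finset.Icc 1 (n - 1)).image (fun ℓ => (Finset.range ℓ).image (fun i => (σ ^ i) (σ h)))

/-- `G` is a `σ`-`k`-Sperner `t`-intersecting family: a `t`-intersecting family of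
intervals of `σ` meeting every chain `C_h` in at most `k` sets. -/
def SigmaKSpernerTIntersecting {n : ℕ} (σ : Equiv.Perm (Fin n)) (k t : ℕ)
    (G : Finset (Finset (Fin n))) : Prop :=
  (∀ A ∈ G, IsIntervalOf σ A) ∧ TIntersecting t G ∧
    ∀ h : Fin n, (G ∩ chainAt σ h).card ≤ k

/-- `G` is consecutive: in every chain `C_h` the lengths of the members of `G ∩ C_h`
form a set of consecutive integers. -/
def ConsecutiveFam {n : ℕ} (σ : Equiv.Perm (Fin n)) (G : Finset (Finset (Fin n))) : Prop :=
  ∀ h : Fin n, ∃ a : ℕ,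
    (G ∩ chainAt σ h).image Finset.card = Finset.Ico a (a + (G ∩ chainAt σ h).card)

/-- `G` is full consecutive: consecutive and meeting every chain `C_h` in exactly `k` sets. -/
def FullConsecutive {n : ℕ} (σ : Equiv.Perm (Fin n)) (k : ℕ)
    (G : Finset (Finset (Fin n))) : Prop :=
  ConsecutiveFam σ G ∧ ∀ h : Fin n, (G ∩ chainAt σ h).card = k

/-- The set `{x, σ x, …, σ^(ℓ-1) x}`. -/
def arc {n : ℕ} (σ : Equiv.Perm (Fin n)) (x : Fin n) (ℓ : ℕ) : Finset (Fin n) :=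
  (Finset.range ℓ).image (fun i => (σ ^ i) x)

lemma mem_arc {n : ℕ} {σ : Equiv.Perm (Fin n)} {x y : Fin n} {ℓ : ℕ} :
    y ∈ arc σ x ℓ ↔ ∃ i < ℓ, (σ ^ i) x = y := by
  simp [arc]

namespace IsCyclicPerm

variable {n : ℕ} {σ : Equiv.Perm (Fin n)}

lemma orderOf_eq (hσ : IsCyclicPerm σ) : orderOf σ = n := by
  rw [hσ.1.orderOf, hσ.2, Finset.card_univ, Fintype.card_fin]

lemma pow_apply_inj (hσ : IsCyclicPerm σ) (x : Fin n) {i j : ℕ} (hi : i < n) (hj : j < n)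
    (h : (σ ^ i) x = (σ ^ j) x) : i = j := by
  wlog hij : i ≤ j generalizing i j
  · exact (this hj hi h.symm (by omega)).symm
  have hx : σ x ≠ x := by
    rw [← Equiv.Perm.mem_support, hσ.2]
    exact Finset.mem_univ x
  have h1 : (σ ^ (j - i)) x = x := by
    apply (σ ^ i).injective
    rw [← Equiv.Perm.mul_apply, ← pow_add, Nat.add_sub_cancel' hij, h]
  have h2 : n ∣ j - i := by
    rw [← hσ.orderOf_eq]
    exact orderOf_dvd_of_pow_eq_one ((hσ.1.pow_eq_one_iff' hx).2 h1)
  have h3 := Nat.eq_zero_of_dvd_of_lt h2 (by omega)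
  omega

lemma card_arc (hσ : IsCyclicPerm σ) (x : Fin n) {ℓ : ℕ} (hℓ : ℓ ≤ n) :
    (arc σ x ℓ).card = ℓ := by
  rw [arc, Finset.card_image_of_injOn, Finset.card_range]
  intro i hi j hj h
  simp only [Finset.coe_range, Set.mem_Iio] at hi hj
  exact hσ.pow_apply_inj x (by omega) (by omega) h

/-- The starting point of a proper nonempty arc is determined by the arc. -/
lemma arc_left_inj (hσ : IsCyclicPerm σ) {x y : Fin n} {ℓ : ℕ} (h0 : 1 ≤ ℓ) (hℓ : ℓ < n)
    (h : arc σ x ℓ = arc σ y ℓ) : x = y := by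
  have hx : x ∈ arc σ y ℓ := h ▸ mem_arc.2 ⟨0, by omega, rfl⟩
  obtain ⟨i, hi, hix⟩ := mem_arc.1 hx
  rcases Nat.eq_zero_or_pos i with rfl | hpos
  · simpa using hix.symm
  have hz : (σ ^ (i - 1)) y ∈ arc σ x ℓ := h ▸ mem_arc.2 ⟨i - 1, by omega, rfl⟩
  obtain ⟨r, hr, hrx⟩ := mem_arc.1 hz
  have hs : (σ ^ (r + 1)) x = (σ ^ 0) x := by
    rw [pow_succ', Equiv.Perm.mul_apply, hrx, ← Equiv.Perm.mul_apply, ← pow_succ',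
      Nat.sub_add_cancel hpos, hix, pow_zero, Equiv.Perm.one_apply]
  have := hσ.pow_apply_inj x (by omega) (by omega) hs
  omega

/-- An arc and an arc starting right after it meet in at most as many elements as the sum of
their lengths exceeds `n`. -/
lemma card_arc_inter_le (hσ : IsCyclicPerm σ) (x : Fin n) {p q : ℕ} (hp : p ≤ n) :
    (arc σ x p ∩ arc σ ((σ ^ p) x) q).card ≤ p + q - n := by
  have hsub : arc σ x p ∩ arc σ ((σ ^ p) x) q ⊆
      (Finset.Ico (n - p) q).image (fun i => (σ ^ i) ((σ ^ p) x)) := by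
    intro z hz
    obtain ⟨hz1, hz2⟩ := Finset.mem_inter.1 hz
    obtain ⟨i, hi, rfl⟩ := mem_arc.1 hz1
    obtain ⟨r, hr, hri⟩ := mem_arc.1 hz2
    refine Finset.mem_image.2 ⟨r, Finset.mem_Ico.2 ⟨?_, hr⟩, hri⟩
    by_contra hlt
    rw [← Equiv.Perm.mul_apply, ← pow_add] at hri
    have := hσ.pow_apply_inj x (by omega) (by omega) hri
    omega
  refine (Finset.card_le_card hsub).trans (Finset.card_image_le.trans ?_)
  rw [Nat.card_Ico]
  omega

lemma mem_chainAt (hσ : IsCyclicPerm σ) {h : Fin n} {S : Finset (Fin n)} :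
    S ∈ chainAt σ h ↔ 1 ≤ S.card ∧ S.card ≤ n - 1 ∧ S = arc σ (σ h) S.card := by
  constructor
  · intro hS
    obtain ⟨ℓ, hℓ, hSℓ⟩ := Finset.mem_image.1 hS
    obtain ⟨h1, h2⟩ := Finset.mem_Icc.1 hℓ
    change arc σ (σ h) ℓ = S at hSℓ
    have hc : S.card = ℓ := hSℓ ▸ hσ.card_arc (σ h) (by omega)
    rw [hc]
    exact ⟨h1, h2, hSℓ.symm⟩
  · rintro ⟨h1, h2, h3⟩
    exact Finset.mem_image.2 ⟨S.card, Finset.mem_Icc.2 ⟨h1, h2⟩, h3.symm⟩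

/-- In a full consecutive family whose members are all of size at most `M`, any member `A`
forces the arc of length `n + t + k - 1 - |A|` starting right after `A` to be a member, unless that
length is less than `M - k + 1`. -/
lemma arc_mem_of_fullConsecutive (hσ : IsCyclicPerm σ) {k t M : ℕ} (ht : 0 < t) (hk : 0 < k)
    {G : Finset (Finset (Fin n))} (hG : TIntersecting t G) (hfull : FullConsecutive σ k G)
    (hM : ∀ A ∈ G, A.card ≤ M) {x : Fin n} {p : ℕ} (hp : p ≤ n) (hA : arc σ x p ∈ G)
    (hL : M + p + 1 ≤ n + t + k - 1 + k) :
    n + t + k - 1 - p < n ∧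
      arc σ ((σ ^ p) x) (n + t + k - 1 - p) ∈ G := by
  set h := σ.symm ((σ ^ p) x) with hh
  have hσh : σ h = (σ ^ p) x := by simp [hh]
  obtain ⟨a, ha⟩ := hfull.1 h
  rw [hfull.2 h] at ha
  have key : ∀ ℓ ∈ Finset.Ico a (a + k),
      1 ≤ ℓ ∧ ℓ ≤ n - 1 ∧ arc σ ((σ ^ p) x) ℓ ∈ G ∧ ℓ ≤ M := by
    intro ℓ hℓ
    rw [← ha] at hℓ
    obtain ⟨S, hS, rfl⟩ := Finset.mem_image.1 hℓ
    obtain ⟨hSG, hSC⟩ := Finset.mem_inter.1 hS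
    obtain ⟨h1, h2, h3⟩ := hσ.mem_chainAt.1 hSC
    rw [hσh] at h3
    exact ⟨h1, h2, h3 ▸ hSG, hM S hSG⟩
  obtain ⟨-, -, hlow, -⟩ := key a (Finset.mem_Ico.2 ⟨le_rfl, by omega⟩)
  obtain ⟨-, -, -, htop⟩ := key (a + k - 1) (Finset.mem_Ico.2 ⟨by omega, by omega⟩)
  have hint := (hG _ hA _ hlow).trans (hσ.card_arc_inter_le x hp)
  obtain ⟨h1, h2, h3, -⟩ := key (n + t + k - 1 - p) (Finset.mem_Ico.2 ⟨by omega, by omega⟩)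
  exact ⟨by omega, h3⟩

lemma card_le_of_chainAt_le (hσ : IsCyclicPerm σ) {k : ℕ} {G : Finset (Finset (Fin n))}
    (hint : ∀ A ∈ G, IsIntervalOf σ A) (hk : ∀ h, (G ∩ chainAt σ h).card ≤ k) :
    G.card ≤ k * n := by
  have hsub : G ⊆ (Finset.univ : Finset (Fin n)).biUnion (fun h => G ∩ chainAt σ h) := by
    intro A hA
    obtain ⟨h1, h2, x, hx⟩ := hint A hA
    refine Finset.mem_biUnion.2 ⟨σ.symm x, Finset.mem_univ _, Finset.mem_inter.2 ⟨hA, ?_⟩⟩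
    refine hσ.mem_chainAt.2 ⟨h1, h2, ?_⟩
    rw [Equiv.apply_symm_apply]
    exact hx
  refine (Finset.card_le_card hsub).trans (Finset.card_biUnion_le.trans ?_)
  refine (Finset.sum_le_sum fun h _ => hk h).trans ?_
  simp [mul_comm]

end IsCyclicPerm

lemma sum_card_filter_card_eq {α : Type*} (G : Finset (Finset α)) (s a b : ℤ) :
    ∑ i ∈ Finset.Icc a b, ((G.filter (fun S => (S.card : ℤ) = s + i)).card : ℤ) =
      ((G.filter (fun S => s + a ≤ (S.card : ℤ) ∧ (S.card : ℤ) ≤ s + b)).card : ℤ) := by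
  rw [Finset.card_eq_sum_card_fiberwise (f := fun S => (S.card : ℤ) - s) (t := Finset.Icc a b)]
  · push_cast
    refine Finset.sum_congr rfl fun i hi => ?_
    rw [Finset.filter_filter]
    congr 2
    ext S
    simp only [Finset.mem_filter, Finset.mem_Icc] at hi ⊢
    constructor <;> rintro ⟨h, h'⟩ <;> refine ⟨h, ?_⟩ <;> omega
  · intro S hS
    simp only [Finset.coe_filter, Set.mem_ofPred_eq, Finset.coe_Icc, Set.mem_Icc] at hS ⊢
    omega

/-- (Lemma on interval counts, inequality (4).)
`∑_{i=-m}^{k+j-2} g_i ≤ kn - ∑_{i=-m}^{-j} g_i` for all `1 ≤ j ≤ m`. -/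
theorem stmt_16 (t k : ℕ) (ht : 0 < t) (hk : 0 < k) :
    ∃ n₀ : ℕ, ∀ n : ℕ, n₀ ≤ n → Even (n + t) →
      ∀ σ : Equiv.Perm (Fin n), IsCyclicPerm σ →
      ∀ m : ℕ, m < k →
      ∀ G : Finset (Finset (Fin n)),
        SigmaKSpernerTIntersecting σ k t G → FullConsecutive σ k G →
        (∀ A ∈ G, ((n + t) / 2 : ℤ) - m ≤ A.card) →
        (∃ A ∈ G, (A.card : ℤ) = ((n + t) / 2 : ℤ) - m) →
        (∀ A ∈ G, (A.card : ℤ) ≤ ((n + t) / 2 : ℤ) + k - 1 + m) →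
        ∀ (g : ℤ → ℕ)
    (hg : ∀ i : ℤ, g i = (G.filter (fun S => (S.card : ℤ) = ((n + t) / 2 : ℤ) + i)).card),
        ∀ j : ℕ, 1 ≤ j → j ≤ m →
          ∑ i ∈ Finset.Icc (-(m : ℤ)) ((k : ℤ) + j - 2), (g i : ℤ) ≤
            (k : ℤ) * n - ∑ i ∈ Finset.Icc (-(m : ℤ)) (-(j : ℤ)), (g i : ℤ) := by
  refine ⟨0, fun n _ heven σ hσ m hm G hG hfull hmin _ hmax g hg j hj hjm => ?_⟩
  obtain ⟨s, hs⟩ := heven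
  have hs' : ((n + t) / 2 : ℤ) = s := by omega
  rw [hs'] at hmin hmax
  simp only [hs'] at hg
  simp only [hg, sum_card_filter_card_eq]
  obtain ⟨hint, hinter, -⟩ := hG
  set P := G.filter
    (fun S => (s : ℤ) + -(m : ℤ) ≤ (S.card : ℤ) ∧ (S.card : ℤ) ≤ s + ((k : ℤ) + j - 2)) with hP
  set Q := G.filter
    (fun S => (s : ℤ) + -(m : ℤ) ≤ (S.card : ℤ) ∧ (S.card : ℤ) ≤ s + -(j : ℤ)) with hQ
  have hGcard := hσ.card_le_of_chainAt_le hint (fun h => (hfull.2 h).le)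
  have hstart : ∀ A : Finset (Fin n), A ∈ Q → ∃ x, A = arc σ x A.card :=
    fun A hA => (hint A (Finset.mem_filter.1 hA).1).2.2
  have hbound : ∀ A ∈ G, A.card ≤ s + k - 1 + m := fun A hA => by
    have := hmax A hA
    omega
  choose x hx using hstart
  have hmem : ∀ A (hA : A ∈ Q), n + t + k - 1 - A.card < n ∧
      arc σ ((σ ^ A.card) (x A hA)) (n + t + k - 1 - A.card) ∈ G := by
    intro A hA
    obtain ⟨hAG, h1, h2⟩ := Finset.mem_filter.1 hA
    have hi := hint A hAG
    exact hσ.arc_mem_of_fullConsecutive ht hk hinter hfull hbound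
      (by have := hi.2.1; omega) (hx A hA ▸ hAG) (by omega)
  have hle : Q.card ≤ (G \ P).card := by
    refine Finset.card_le_card_of_injOn
      (fun A => if hA : A ∈ Q then
        arc σ ((σ ^ A.card) (x A hA)) (n + t + k - 1 - A.card) else ∅) ?_ ?_
    · intro A hA
      have hA' : A ∈ Q := hA
      obtain ⟨hlt, hB⟩ := hmem A hA'
      obtain ⟨hAG, h1, h2⟩ := Finset.mem_filter.1 hA'
      simp only [dif_pos hA', Finset.mem_coe, Finset.mem_sdiff]
      refine ⟨hB, fun hBP => ?_⟩
      have := (Finset.mem_filter.1 hBP).2.2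
      rw [hσ.card_arc _ hlt.le] at this
      omega
    · intro A hA B hB hAB
      have hA' : A ∈ Q := hA
      have hB' : B ∈ Q := hB
      simp only [dif_pos hA', dif_pos hB'] at hAB
      have hltA := (hmem A hA').1
      have hltB := (hmem B hB').1
      have hAi := (hint A (Finset.mem_filter.1 hA').1).2.1
      have hBi := (hint B (Finset.mem_filter.1 hB').1).2.1
      have hcard : A.card = B.card := by
        have := congrArg Finset.card hAB
        rw [hσ.card_arc _ hltA.le, hσ.card_arc _ hltB.le] at this
        omega
      rw [hcard] at hAB
      have hxy := (σ ^ B.card).injective (hσ.arc_left_inj (by omega) hltB hAB)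
      rw [hx A hA', hx B hB', hxy, hcard]
  have hsum : P.card + (G \ P).card = G.card := by
    have hPG : P ⊆ G := Finset.filter_subset _ _
    have := Finset.card_sdiff_add_card_eq_card hPG
    omega
  have : ((P.card + Q.card : ℕ) : ℤ) ≤ ((k * n : ℕ) : ℤ) := by
    exact_mod_cast (by omega : P.card + Q.card ≤ k * n)
  push_cast at this
  linarith
end

section
/- Let t, k, n be positive integers with n+t odd and n ≥ t + 2k. Define B(t,k) ⊆ 2^[n] as the union of: (i) all sets of size (n+t−1)/2 that contain [t] = {1,...,t}; (ii) all sets whose size is between (n+t−1)/2 + 1 and (n+t−1)/2 + (k−1); and (iii) all sets of size (n+t−1)/2 + k that do not contain [t]. Then B(t,k) is a t-intersecting k-Sperner family and |B(t,k)| = C(n−t, (n−t−1)/2) + Σ_{i=1}^{k} C(n, (n+t−1)/2 + i) − C(n−t, (n−t−1)/2 + k). -/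
open Finset

/-- `F` is `k`-Sperner: it contains no chain of `k+1` sets `A_0 ⊊ A_1 ⊊ … ⊊ A_k`. -/
def IsKSperner {n : ℕ} (k : ℕ) (F : Finset (Finset (Fin n))) : Prop :=
  ¬ ∃ c : Fin (k + 1) → Finset (Fin n),
      (∀ i, c i ∈ F) ∧ ∀ i j : Fin (k + 1), i < j → c i ⊂ c j

/-- The family `B(t,k) ⊆ 2^[n]`: all sets of size `(n+t-1)/2` containing `[t]`, all sets of
size between `(n+t-1)/2 + 1` and `(n+t-1)/2 + (k-1)`, and all sets of size `(n+t-1)/2 + k`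
not containing `[t]`. -/
def Bfam (n t k : ℕ) : Finset (Finset (Fin n)) :=
  (Finset.univ.filter (fun S : Finset (Fin n) =>
      S.card = (n + t - 1) / 2 ∧ Finset.univ.filter (fun x : Fin n => (x : ℕ) < t) ⊆ S)) ∪
  (Finset.univ.filter (fun S : Finset (Fin n) =>
      (n + t - 1) / 2 + 1 ≤ S.card ∧ S.card ≤ (n + t - 1) / 2 + (k - 1))) ∪
  (Finset.univ.filter (fun S : Finset (Fin n) =>
      S.card = (n + t - 1) / 2 + k ∧ ¬ Finset.univ.filter (fun x : Fin n => (x : ℕ) < t) ⊆ S))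

/-- Inclusion–exclusion bound: two sets intersect in at least `#A + #B - n` elements. -/
theorem card_add_card_le_card_inter_add {n : ℕ} (A B : Finset (Fin n)) :
    A.card + B.card ≤ (A ∩ B).card + n := by
  have h := card_union_add_card_inter A B
  have h' := card_le_univ (A ∪ B)
  rw [Fintype.card_fin] at h'
  omega

theorem card_filter_card_eq_subset {α : Type*} [Fintype α] [DecidableEq α] (T : Finset α) {r : ℕ}
    (hr : T.card ≤ r) :
    (univ.filter fun S : Finset α => S.card = r ∧ T ⊆ S).card =
      (Fintype.card α - T.card).choose (r - T.card) := by
  rw [← card_compl, ← card_powersetCard]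
  refine card_bij' (fun S _ => S \ T) (fun S _ => S ∪ T) ?_ ?_ ?_ ?_
  · intro S hS
    simp only [mem_filter, mem_univ, true_and] at hS
    rw [mem_powersetCard, card_sdiff_of_subset hS.2, hS.1]
    exact ⟨fun x hx => mem_compl.2 (mem_sdiff.1 hx).2, rfl⟩
  · intro S hS
    rw [mem_powersetCard] at hS
    have hd : Disjoint S T := disjoint_left.2 fun x hx => mem_compl.1 (hS.1 hx)
    simp only [mem_filter, mem_univ, true_and]
    rw [card_union_of_disjoint hd]
    exact ⟨by omega, subset_union_right⟩
  · intro S hS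
    simp only [mem_filter, mem_univ, true_and] at hS
    exact sdiff_union_of_subset hS.2
  · intro S hS
    rw [mem_powersetCard] at hS
    have hd : Disjoint S T := disjoint_left.2 fun x hx => mem_compl.1 (hS.1 hx)
    exact union_sdiff_cancel_right hd

theorem card_filter_card_eq_not_subset {α : Type*} [Fintype α] [DecidableEq α] (T : Finset α)
    {r : ℕ} (hr : T.card ≤ r) :
    ((univ.filter fun S : Finset α => S.card = r ∧ ¬ T ⊆ S).card : ℤ) =
      ((Fintype.card α).choose r : ℤ) -
        ((Fintype.card α - T.card).choose (r - T.card) : ℤ) := by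
  have h := card_filter_add_card_filter_not
    (s := univ.filter fun S : Finset α => S.card = r) (p := fun S => T ⊆ S)
  rw [filter_filter, filter_filter, card_filter_card_eq_subset T hr,
    univ_filter_card_eq, card_powersetCard, card_univ] at h
  omega

theorem card_filter_lt_card_le {α : Type*} [Fintype α] [DecidableEq α] (m j : ℕ) :
    (univ.filter fun S : Finset α => m + 1 ≤ S.card ∧ S.card ≤ m + j).card =
      ∑ i ∈ Icc 1 j, (Fintype.card α).choose (m + i) := by
  have h := card_eq_sum_card_fiberwise
    (s := univ.filter fun S : Finset α => m + 1 ≤ S.card ∧ S.card ≤ m + j)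
    (t := Icc 1 j) (f := fun S => S.card - m) (fun S hS => by
      simp only [coe_filter, mem_univ, true_and, Set.mem_ofPred_eq] at hS
      simp only [coe_Icc, Set.mem_Icc]
      omega)
  rw [h]
  refine sum_congr rfl fun i hi => ?_
  rw [mem_Icc] at hi
  rw [← card_univ, ← card_powersetCard, ← univ_filter_card_eq, filter_filter]
  congr 1
  ext S
  simp only [mem_filter, mem_univ, true_and]
  omega

/-- A chain of sets indexed by `Fin (k + 1)` has sizes increasing by at least one per step. -/
theorem card_zero_add_le_of_chain {α : Type*} {k : ℕ} {c : Fin (k + 1) → Finset α}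
    (hc : ∀ i j : Fin (k + 1), i < j → c i ⊂ c j) :
    (c 0).card + k ≤ (c (Fin.last k)).card := by
  have h : ∀ i (hi : i < k + 1), (c 0).card + i ≤ (c ⟨i, hi⟩).card := by
    intro i
    induction i with
    | zero => intro _; exact le_rfl
    | succ i ih =>
      intro hi
      have h₁ := ih (by omega)
      have h₂ := card_lt_card (hc ⟨i, by omega⟩ ⟨i + 1, hi⟩ (Fin.mk_lt_mk.2 (by omega)))
      omega
  exact h k (by omega)

theorem mem_Bfam {n t k : ℕ} {S : Finset (Fin n)} :
    S ∈ Bfam n t k ↔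
      (S.card = (n + t - 1) / 2 ∧ univ.filter (fun x : Fin n => (x : ℕ) < t) ⊆ S) ∨
      ((n + t - 1) / 2 + 1 ≤ S.card ∧ S.card ≤ (n + t - 1) / 2 + (k - 1)) ∨
      (S.card = (n + t - 1) / 2 + k ∧
        ¬ univ.filter (fun x : Fin n => (x : ℕ) < t) ⊆ S) := by
  simp only [Bfam, mem_union, mem_filter, mem_univ, true_and, or_assoc]

/-- If `n + t` is odd and `n ≥ t + 2k`, then `B(t,k)` is a `t`-intersecting
`k`-Sperner family of size
`C(n-t, (n-t-1)/2) + ∑_{i=1}^{k} C(n, (n+t-1)/2 + i) - C(n-t, (n-t-1)/2 + k)`. -/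
theorem stmt_19 (n t k : ℕ) (hn : 0 < n) (ht : 0 < t) (hk : 0 < k)
    (hpar : Odd (n + t)) (hntk : t + 2 * k ≤ n) :
    TIntersecting t (Bfam n t k) ∧ IsKSperner k (Bfam n t k) ∧
    ((Bfam n t k).card : ℤ) =
      ((n - t).choose ((n - t - 1) / 2) : ℤ) +
        ∑ i ∈ Finset.Icc 1 k, (n.choose ((n + t - 1) / 2 + i) : ℤ) -
        ((n - t).choose ((n - t - 1) / 2 + k) : ℤ) := by
  obtain ⟨m, hm⟩ := hpar
  have hm' : (n + t - 1) / 2 = m := by omega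
  have hT : (univ.filter (fun x : Fin n => (x : ℕ) < t)).card = t := by
    rw [Fin.card_filter_val_lt, min_eq_right (by omega)]
  refine ⟨?_, ?_, ?_⟩
  · intro A hA B hB
    rw [mem_Bfam, hm'] at hA hB
    have h := card_add_card_le_card_inter_add A B
    by_cases hAB : A.card = m ∧ B.card = m
    · have hTA : univ.filter (fun x : Fin n => (x : ℕ) < t) ⊆ A := by
        rcases hA with hA | hA | hA
        · exact hA.2
        all_goals omega
      have hTB : univ.filter (fun x : Fin n => (x : ℕ) < t) ⊆ B := by
        rcases hB with hB | hB | hB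
        · exact hB.2
        all_goals omega
      simpa only [hT] using card_le_card (subset_inter hTA hTB)
    · omega
  · rintro ⟨c, hcF, hc⟩
    have hcard := card_zero_add_le_of_chain hc
    have h₀ := hcF 0
    have h₁ := hcF (Fin.last k)
    rw [mem_Bfam, hm'] at h₀ h₁
    have hsub : c 0 ⊆ c (Fin.last k) := (hc 0 (Fin.last k) (Fin.lt_def.2 hk)).subset
    have hT₀ : univ.filter (fun x : Fin n => (x : ℕ) < t) ⊆ c 0 := by
      rcases h₀ with h₀ | h₀ | h₀
      · exact h₀.2
      all_goals omega
    rcases h₁ with h₁ | h₁ | h₁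
    · omega
    · omega
    · exact h₁.2 (hT₀.trans hsub)
  · have e₁ : (n - t - 1) / 2 = m - t := by omega
    have e₂ : m + k - t = m - t + k := by omega
    obtain ⟨j, rfl⟩ : ∃ j, k = j + 1 := ⟨k - 1, by omega⟩
    have c₁ := card_filter_card_eq_subset
      (univ.filter (fun x : Fin n => (x : ℕ) < t)) (r := m) (by omega)
    have c₂ := card_filter_lt_card_le (α := Fin n) m j
    have c₃ := card_filter_card_eq_not_subset
      (univ.filter (fun x : Fin n => (x : ℕ) < t)) (r := m + (j + 1)) (by omega)
    rw [hT, Fintype.card_fin] at c₁ c₃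
    rw [Fintype.card_fin] at c₂
    rw [e₂] at c₃
    rw [Bfam, hm', e₁, add_tsub_cancel_right, card_union_of_disjoint, card_union_of_disjoint,
      Nat.cast_add, Nat.cast_add, c₁, c₂, c₃, sum_Icc_succ_top (by omega)]
    · push_cast
      ring
    · rw [disjoint_left]
      intro S
      simp only [mem_filter, mem_univ, true_and]
      omega
    · rw [disjoint_left]
      intro S
      simp only [mem_union, mem_filter, mem_univ, true_and]
      omega
end
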